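/- Suppose E[f(R)] = ᾱ and P(f(R) ≠ ᾱ) > 0, G_f is measurable and non-decreasing, and Φ(R, f(R)), Φ(R, ᾱ), G_f(R), and G_f(R)·f(R) are all integrable. Then the relevance-aware adaptive allocation strictly improves expected utility over the uniform allocation: E[Φ(R, f(R))] > E[Φ(R, ᾱ)]. -/

import Mathlib

open MeasureTheory Set

/-- The graph of a strictly concave function lies strictly below its tangents. -/
lemma StrictConcaveOn.lt_tangent {S : Set ℝ} {g : ℝ → ℝ} {x y : ℝ}
    (hg : StrictConcaveOn ℝ S g) (hx : x ∈ S) (hy : y ∈ S) (hxy : x ≠ y)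
    (hd : DifferentiableAt ℝ g x) : g y < g x + deriv g x * (y - x) := by
  rcases lt_or_gt_of_ne hxy with h | h
  · have := hg.slope_lt_deriv hx hy h hd
    rw [slope_def_field, div_lt_iff₀ (sub_pos.2 h)] at this
    linarith
  · have := hg.deriv_lt_slope hy hx h hd
    rw [slope_def_field, lt_div_iff₀ (sub_pos.2 h)] at this
    linarith

/-- **Chebyshev's association inequality** for random variables. -/
lemma Monovary.integral_mul_integral_le {Ω : Type*} [MeasurableSpace Ω] {μ : Measure Ω}
    [IsProbabilityMeasure μ] {X Y : Ω → ℝ} (h : Monovary X Y) (hX : Integrable X μ)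
    (hY : Integrable Y μ) (hXY : Integrable (fun ω => X ω * Y ω) μ) :
    (∫ ω, X ω ∂μ) * (∫ ω, Y ω ∂μ) ≤ ∫ ω, X ω * Y ω ∂μ := by
  have key (ω' : Ω) : X ω' * (∫ ω, Y ω ∂μ) + (∫ ω, X ω ∂μ) * Y ω' ≤
      (∫ ω, X ω * Y ω ∂μ) + X ω' * Y ω' := by
    have := integral_mono (μ := μ) ((hY.const_mul (X ω')).add (hX.mul_const (Y ω')))
      (hXY.add (integrable_const (X ω' * Y ω')))
      (fun ω => by
        have := monovary_iff_forall_mul_nonneg.1 h ω ω'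
        simp only [Pi.add_apply]
        linarith)
    rw [integral_add' (hY.const_mul _) (hX.mul_const _), integral_const_mul, integral_mul_const,
      integral_add' hXY (integrable_const _), integral_const] at this
    simpa only [probReal_univ, one_smul] using this
  have := integral_mono (μ := μ) ((hX.mul_const _).add (hY.const_mul _))
    ((integrable_const _).add hXY) key
  rw [integral_add' (hX.mul_const _) (hY.const_mul _), integral_mul_const, integral_const_mul,
    integral_add' (integrable_const _) hXY, integral_const] at this
  simp only [probReal_univ, one_smul] at this
  linarith

/-- **Utility Advantage of Relevance-Aware Allocation (strict version).**
Under a budget-balanced, non-trivial, monotone allocation `f` into an open interval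
`𝒜 = Ioo a b` of positive reals, with `Φ(r, ·)` differentiable and strictly concave
on `𝒜` and the allocated marginal utility `Gf` measurable and non-decreasing,
the adaptive allocation strictly improves expected utility over the uniform one:
`E[Φ(R, f(R))] > E[Φ(R, ᾱ)]`. -/
theorem adaptive_allocation_strict_utility_gain
    {Ω : Type*} [MeasurableSpace Ω] (μ : Measure Ω) [IsProbabilityMeasure μ]
    (R : Ω → ℝ) (hRmeas : Measurable R)
    (𝓡 : Set ℝ) (hsupp : ∀ ω, R ω ∈ 𝓡)
    (a b ᾱ : ℝ) (hᾱpos : 0 < ᾱ)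
    (hApos : Ioo a b ⊆ Ioi (0 : ℝ)) (hᾱA : ᾱ ∈ Ioo a b)
    (Φ : ℝ → ℝ → ℝ)
    (hΦmeas : ∀ α ∈ Ioo a b, Measurable fun r => Φ r α)
    (hΦdiff : ∀ r ∈ 𝓡, ∀ α ∈ Ioo a b, DifferentiableAt ℝ (Φ r) α)
    (hΦconc : ∀ r ∈ 𝓡, StrictConcaveOn ℝ (Ioo a b) (Φ r))
    (f : ℝ → ℝ) (hfmeas : Measurable f) (hfmono : MonotoneOn f 𝓡)
    (hfmaps : ∀ r ∈ 𝓡, f r ∈ Ioo a b)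
    (Gf : ℝ → ℝ) (hGf : ∀ r ∈ 𝓡, Gf r = deriv (Φ r) (f r))
    (hfint : Integrable (fun ω => f (R ω)) μ)
    (hbudget : ∫ ω, f (R ω) ∂μ = ᾱ)
    (hnontrivial : 0 < μ {ω | f (R ω) ≠ ᾱ})
    (hGfmeas : Measurable Gf) (hGfmono : MonotoneOn Gf 𝓡)
    (hint1 : Integrable (fun ω => Φ (R ω) (f (R ω))) μ)
    (hint2 : Integrable (fun ω => Φ (R ω) ᾱ) μ)
    (hint3 : Integrable (fun ω => Gf (R ω)) μ)
    (hint4 : Integrable (fun ω => Gf (R ω) * f (R ω)) μ) :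
    ∫ ω, Φ (R ω) ᾱ ∂μ < ∫ ω, Φ (R ω) (f (R ω)) ∂μ := by
  have hmono : Monovary (fun ω => Gf (R ω)) (fun ω => f (R ω)) := by
    intro i j hij
    rcases le_total (R i) (R j) with h | h
    · exact hGfmono (hsupp i) (hsupp j) h
    · exact absurd (hfmono (hsupp j) (hsupp i) h) hij.not_ge
  have hcov := hmono.integral_mul_integral_le hint3 hfint hint4
  have htan (ω : Ω) (hω : f (R ω) ≠ ᾱ) :
      Φ (R ω) ᾱ < Φ (R ω) (f (R ω)) + Gf (R ω) * (ᾱ - f (R ω)) := by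
    rw [hGf _ (hsupp ω)]
    exact (hΦconc _ (hsupp ω)).lt_tangent (hfmaps _ (hsupp ω)) hᾱA hω
      (hΦdiff _ (hsupp ω) _ (hfmaps _ (hsupp ω)))
  have hlin : Integrable (fun ω => Gf (R ω) * ᾱ - Gf (R ω) * f (R ω)) μ :=
    (hint3.mul_const ᾱ).sub hint4
  have hsum : Integrable
      (fun ω => Φ (R ω) (f (R ω)) + (Gf (R ω) * ᾱ - Gf (R ω) * f (R ω))) μ :=
    hint1.add hlin
  have hpos : 0 < ∫ ω, (Φ (R ω) (f (R ω)) + (Gf (R ω) * ᾱ - Gf (R ω) * f (R ω))) -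
      Φ (R ω) ᾱ ∂μ := by
    refine (integral_pos_iff_support_of_nonneg (fun ω => ?_) (hsum.sub hint2)).2
      (hnontrivial.trans_le (measure_mono fun ω hω => ?_))
    · by_cases hω : f (R ω) = ᾱ
      · simp [hω]
      · have := htan ω hω
        simp only [Pi.zero_apply, Pi.sub_apply]
        linarith
    · have := htan ω hω
      simp only [Function.mem_support, Pi.sub_apply]
      exact ne_of_gt (by linarith)
  rw [integral_sub hsum hint2, integral_add hint1 hlin, integral_sub (hint3.mul_const ᾱ) hint4,
    integral_mul_const] at hpos
  rw [hbudget] at hcov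
  linarith
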